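/- Let n ≥ 2, R > 0, σ ≥ 0, and B_R^c = {x ∈ ℝⁿ : |x| > R}. For every smooth compactly supported real-valued function u on ℝⁿ, ∫_{B_R^c} |∇u|² dx + σ∫_{∂B_R} |u|² dν ≥ (1/4)∫_{B_R^c} (|x| − R + 1/(2σ))⁻² |u(x)|² dx + ((n−1)(n−3)/4)∫_{B_R^c} |u(x)|²/|x|² dx. (For σ = 0 interpret (|x| − R + 1/(2σ))⁻² as 0, or state the result for σ > 0 only.) -/

import Mathlib

open MeasureTheory
open Set Metric Filter Topology
open scoped Pointwise ENNReal NNReal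

theorem erh_normalize_lip {E : Type*} [NormedAddCommGroup E] [NormedSpace ℝ E] :
    LipschitzOnWith 2 (fun x : E => ‖x‖⁻¹ • x) {x | 1 ≤ ‖x‖} := by
  refine LipschitzOnWith.of_dist_le_mul ?_
  intro x hx y hy
  have hx : 1 ≤ ‖x‖ := hx
  have hy : 1 ≤ ‖y‖ := hy
  have hx0 : 0 < ‖x‖ := by linarith
  have hy0 : 0 < ‖y‖ := by linarith
  rw [dist_eq_norm, dist_eq_norm]
  have e : ‖x‖⁻¹ • x - ‖y‖⁻¹ • y = ‖x‖⁻¹ • (x - y) + (‖x‖⁻¹ - ‖y‖⁻¹) • y := by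
    module
  rw [e]
  refine (norm_add_le _ _).trans ?_
  rw [norm_smul, norm_smul, norm_inv, norm_norm]
  have h1 : ‖x‖⁻¹ ≤ 1 := inv_le_one_of_one_le₀ hx
  have h2 : ‖‖x‖⁻¹ - ‖y‖⁻¹‖ * ‖y‖ = ‖x‖⁻¹ * |‖y‖ - ‖x‖| := by
    have : ‖x‖⁻¹ - ‖y‖⁻¹ = ‖x‖⁻¹ * ‖y‖⁻¹ * (‖y‖ - ‖x‖) := by field_simp
    rw [this, norm_mul, norm_mul, norm_inv, norm_inv, norm_norm, norm_norm, Real.norm_eq_abs]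
    field_simp
  rw [h2]
  have h3 : |‖y‖ - ‖x‖| ≤ ‖x - y‖ := by
    rw [norm_sub_rev]; exact abs_norm_sub_norm_le y x
  have := norm_nonneg (x - y)
  have h4 := abs_nonneg (‖y‖ - ‖x‖)
  have h5 : 0 ≤ ‖x‖⁻¹ := by positivity
  push_cast
  nlinarith

theorem erh_sphere_finite (m : ℕ) :
    μH[((m+1 : ℕ) : ℝ)] (sphere (0 : EuclideanSpace ℝ (Fin (m+2))) 1) < ∞ := by
  let g : Fin (m+2) → ℝ → (Fin (m+1) → ℝ) → EuclideanSpace ℝ (Fin (m+2)) :=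
    fun i s v => WithLp.toLp 2 (i.insertNth (α := fun _ => ℝ) s v)
  have hg1 : ∀ i s v, |s| = 1 → 1 ≤ ‖g i s v‖ := by
    intro i s v hs
    have := PiLp.norm_apply_le (g i s v) i
    simpa [g, hs] using this
  have hgl : ∀ i s, ∃ K : ℝ≥0, LipschitzWith K (g i s) := by
    intro i s
    have h1 : LipschitzWith 1 (fun v : Fin (m+1) → ℝ => (i.insertNth (α := fun _ => ℝ) s v : Fin (m+2) → ℝ)) := by
      refine LipschitzWith.of_dist_le_mul ?_
      intro v w
      simp only [NNReal.coe_one, one_mul]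
      rw [dist_pi_le_iff dist_nonneg]
      intro j
      refine i.succAboveCases ?_ ?_ j
      · simp
      · intro j
        simpa using dist_le_pi_dist v w j
    exact ⟨_, (PiLp.lipschitzWith_toLp 2 (fun _ : Fin (m+2) => ℝ)).comp h1⟩
  have hsub : sphere (0 : EuclideanSpace ℝ (Fin (m+2))) 1 ⊆
      ⋃ i : Fin (m+2), ((fun v => ‖g i 1 v‖⁻¹ • g i 1 v) '' Icc (-1) 1 ∪
        (fun v => ‖g i (-1) v‖⁻¹ • g i (-1) v) '' Icc (-1) 1) := by
    intro y hy
    have hy1 : ‖y‖ = 1 := by simpa using hy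
    obtain ⟨i, -, hi⟩ := Finset.exists_max_image (Finset.univ : Finset (Fin (m+2)))
      (fun i => |y i|) ⟨0, Finset.mem_univ _⟩
    have hyi : 0 < |y i| := by
      by_contra hcon
      have hz : y = 0 := by
        ext j
        have := hi j (Finset.mem_univ _)
        have h2 := abs_nonneg (y j)
        have : |y j| = 0 := by linarith
        simpa using this
      simp [hz] at hy1
    set v : Fin (m+1) → ℝ := fun j => |y i|⁻¹ * y (i.succAbove j) with hv
    have hvm : v ∈ Icc (-1 : Fin (m+1) → ℝ) 1 := by
      have : ∀ j, |v j| ≤ 1 := by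
        intro j
        simp only [hv, abs_mul, abs_inv, abs_abs]
        rw [inv_mul_le_iff₀ hyi, mul_one]
        exact hi _ (Finset.mem_univ _)
      exact ⟨fun j => (abs_le.1 (this j)).1, fun j => (abs_le.1 (this j)).2⟩
    have hz : ∀ s, s = |y i|⁻¹ * y i → ‖g i s v‖⁻¹ • g i s v = y := by
      intro s hs
      have e : g i s v = |y i|⁻¹ • y := by
        ext j
        refine i.succAboveCases ?_ ?_ j
        · simp [g, hs]
        · intro j; simp [g, hv]
      rw [e, norm_smul, hy1, smul_smul]
      simp [hyi.ne']
    rw [mem_iUnion]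
    refine ⟨i, ?_⟩
    rcases lt_or_gt_of_ne (abs_pos.1 hyi) with h | h
    · right
      refine ⟨v, hvm, hz _ ?_⟩
      have := h.ne; rw [abs_of_neg h]; field_simp
    · left
      refine ⟨v, hvm, hz _ ?_⟩
      rw [abs_of_pos h]; field_simp
  refine (measure_mono hsub).trans_lt ?_
  refine (measure_iUnion_fintype_le _ _).trans_lt ?_
  refine ENNReal.sum_lt_top.2 ?_
  intro i _
  have key : ∀ s, |s| = 1 → μH[((m+1 : ℕ) : ℝ)] ((fun v => ‖g i s v‖⁻¹ • g i s v) '' Icc (-1) 1) < ∞ := by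
    intro s hs
    obtain ⟨K, hK⟩ := hgl i s
    have hl : LipschitzOnWith (2 * K) (fun v => ‖g i s v‖⁻¹ • g i s v) (Icc (-1) 1) :=
      erh_normalize_lip.comp hK.lipschitzOnWith (fun v _ => hg1 i s v hs)
    refine (hl.hausdorffMeasure_image_le (by positivity)).trans_lt ?_
    have : (μH[((m+1 : ℕ) : ℝ)] : Measure (Fin (m+1) → ℝ)) = volume := by
      have := hausdorffMeasure_pi_real (ι := Fin (m+1))
      rwa [Fintype.card_fin] at this
    rw [this]
    refine ENNReal.mul_lt_top (ENNReal.rpow_lt_top_of_nonneg (by positivity) ENNReal.coe_ne_top) ?_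
    exact isCompact_Icc.measure_lt_top
  exact (measure_union_le _ _).trans_lt (ENNReal.add_lt_top.2 ⟨key 1 (by simp), key (-1) (by simp)⟩)

theorem erh_box {m : ℕ} (b : OrthonormalBasis (Fin (m+2)) ℝ (EuclideanSpace ℝ (Fin (m+2))))
    (S : Set (EuclideanSpace ℝ (Fin (m+2)))) (p q : ℝ)
    (h0 : ∀ y ∈ S, ∀ z ∈ S, |inner ℝ (b 0) y - inner ℝ (b 0) z| ≤ p)
    (h1 : ∀ i, i ≠ 0 → ∀ y ∈ S, ∀ z ∈ S, |inner ℝ (b i) y - inner ℝ (b i) z| ≤ q) :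
    volume S ≤ ENNReal.ofReal p * ENNReal.ofReal q ^ (m+1) := by
  let φ : EuclideanSpace ℝ (Fin (m+2)) → (Fin (m+2) → ℝ) := fun y => (b.repr y).ofLp
  have mp : MeasurePreserving φ volume volume :=
    (PiLp.volume_preserving_ofLp (Fin (m+2))).comp b.measurePreserving_repr
  have hS : volume S ≤ volume (φ '' S) := by
    have hinj : S ⊆ φ ⁻¹' (φ '' S) := subset_preimage_image _ _
    exact (measure_mono hinj).trans (mp.measure_preimage_le _)
  refine hS.trans ((Real.volume_pi_le_prod_diam _).trans ?_)
  rw [Fin.prod_univ_succ]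
  have hd : ∀ i c, (∀ y ∈ S, ∀ z ∈ S, |inner ℝ (b i) y - inner ℝ (b i) z| ≤ c) →
      ediam (Function.eval i '' (φ '' S)) ≤ ENNReal.ofReal c := by
    intro i c hc
    refine ediam_le ?_
    rintro _ ⟨_, ⟨y, hy, rfl⟩, rfl⟩ _ ⟨_, ⟨z, hz, rfl⟩, rfl⟩
    rw [edist_dist]
    refine ENNReal.ofReal_le_ofReal ?_
    simpa [φ, Real.dist_eq, OrthonormalBasis.repr_apply_apply] using hc y hy z hz
  gcongr
  · exact hd 0 p h0
  · refine (Finset.prod_le_prod' (fun i _ => hd i.succ q (h1 _ (Fin.succ_ne_zero i)))).trans ?_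
    simp

theorem erh_basis {m : ℕ} (x : EuclideanSpace ℝ (Fin (m+2))) (hx : ‖x‖ = 1) :
    ∃ b : OrthonormalBasis (Fin (m+2)) ℝ (EuclideanSpace ℝ (Fin (m+2))), b 0 = x := by
  have hv : Orthonormal ℝ (({0} : Set (Fin (m+2))).domRestrict (fun _ => x)) := by
    refine ⟨fun i => hx, ?_⟩
    intro i j hij
    exact absurd (Subsingleton.elim i j) hij
  obtain ⟨b, hb⟩ := hv.exists_orthonormalBasis_extension_of_card_eq (by simp)
  exact ⟨b, hb 0 (by simp)⟩

/-- volume of the thin shell over a small piece of the unit sphere -/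
theorem erh_shell {m : ℕ} (t : Set (EuclideanSpace ℝ (Fin (m+2)))) (ht : ∀ y ∈ t, ‖y‖ = 1)
    (δ d : ℝ) (hδ : 0 < δ) (hδ1 : δ < 1) (hdδ : d ≤ δ) (htd : ∀ y ∈ t, ∀ z ∈ t, ‖y - z‖ ≤ d) :
    volume (Ico (1 - δ) 1 • t) ≤
      ENNReal.ofReal (δ + δ^2/2) * ENNReal.ofReal ((1 + δ) * d) ^ (m+1) := by
  rcases t.eq_empty_or_nonempty with rfl | ⟨x, hxt⟩
  · simp
  have hx := ht x hxt
  obtain ⟨b, hb⟩ := erh_basis x hx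
  have hd0 : 0 ≤ d := by simpa using htd x hxt x hxt
  refine erh_box b _ _ _ ?_ ?_
  · have key : ∀ y ∈ Ico (1 - δ) 1 • t, inner ℝ (b 0) y ∈ Icc (1 - (δ + δ^2/2)) 1 := by
      rintro _ ⟨r, hr, y, hy, rfl⟩
      simp only [hb, inner_smul_right]
      have h1 := norm_sub_sq_real x y
      rw [hx, ht y hy] at h1
      have h2 := htd x hxt y hy
      have h3 := norm_nonneg (x - y)
      have h4 : ‖x - y‖ ^ 2 ≤ δ ^ 2 := by
        have := h2.trans hdδ
        gcongr
      have h5 : 1 - δ^2/2 ≤ inner ℝ x y := by linarith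
      have h6 : inner ℝ x y ≤ 1 := by nlinarith [sq_nonneg ‖x - y‖]
      have hr1 := hr.1
      have hr2 := hr.2
      have h7 : 0 < 1 - δ^2/2 := by nlinarith
      constructor <;> nlinarith
    intro y hy z hz
    have h1 := key y hy
    have h2 := key z hz
    rw [abs_le]
    constructor <;> linarith [h1.1, h1.2, h2.1, h2.2]
  · intro i hi
    rintro _ ⟨r, hr, y, hy, rfl⟩ _ ⟨s, hs, z, hz, rfl⟩
    simp only [inner_smul_right]
    have hbx : inner ℝ (b i) x = 0 := by
      rw [← hb]; exact b.orthonormal.2 hi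
    have h1 : |inner ℝ (b i) y - inner ℝ (b i) z| ≤ d := by
      rw [← inner_sub_right]
      refine (abs_real_inner_le_norm _ _).trans ?_
      simpa using htd y hy z hz
    have h2 : |inner ℝ (b i) z| ≤ d := by
      have : inner ℝ (b i) z = inner ℝ (b i) (z - x) := by rw [inner_sub_right, hbx, sub_zero]
      rw [this]
      refine (abs_real_inner_le_norm _ _).trans ?_
      simpa using htd z hz x hxt
    have e : r * inner ℝ (b i) y - s * inner ℝ (b i) z =
      r * (inner ℝ (b i) y - inner ℝ (b i) z) + (r - s) * inner ℝ (b i) z := by ring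
    rw [e]
    refine (abs_add_le _ _).trans ?_
    rw [abs_mul, abs_mul]
    have h3 : |r| ≤ 1 := by rw [abs_le]; constructor <;> linarith [hr.1, hr.2]
    have h4 : |r - s| ≤ δ := by rw [abs_le]; constructor <;> linarith [hr.1, hr.2, hs.1, hs.2]
    calc |r| * |inner ℝ (b i) y - inner ℝ (b i) z| + |r - s| * |inner ℝ (b i) z|
        ≤ 1 * d + δ * d := by gcongr
      _ = _ := by ring

noncomputable def erhC (m : ℕ) (δ : ℝ) : ℝ :=
  ((m:ℝ)+2) * (1 + δ/2) * (1+δ)^(m+1) / (∑ i ∈ Finset.range (m+2), (1-δ)^i)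

theorem erhC_pos (m : ℕ) (δ : ℝ) (hδ : 0 < δ) (hδ1 : δ < 1) : 0 < erhC m δ := by
  unfold erhC
  have : 0 < ∑ i ∈ Finset.range (m+2), (1-δ)^i :=
    Finset.sum_pos (fun i _ => pow_pos (by linarith) i) (by simp)
  positivity

theorem erhC_tendsto (m : ℕ) : Tendsto (erhC m) (𝓝[>] 0) (𝓝 1) := by
  have h : ContinuousAt (erhC m) 0 := by
    unfold erhC
    refine ContinuousAt.div (by fun_prop) (by fun_prop) ?_
    simp
    positivity
  have h0 : erhC m 0 = 1 := by
    unfold erhC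
    have : (m:ℝ) + 2 ≠ 0 := by positivity
    simp
    exact this
  have := h.tendsto
  rw [h0] at this
  exact this.mono_left nhdsWithin_le_nhds

theorem erh_piece {m : ℕ} (t : Set (sphere (0 : EuclideanSpace ℝ (Fin (m+2))) 1))
    (htc : MeasurableSet t)
    (δ : ℝ) (hδ : 0 < δ) (hδ1 : δ < 1) (htd : ediam t ≤ ENNReal.ofReal δ) :
    (volume : Measure (EuclideanSpace ℝ (Fin (m+2)))).toSphere t ≤
      ENNReal.ofReal (erhC m δ) * ediam t ^ ((m+1 : ℕ) : ℝ) := by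
  set T : Set (EuclideanSpace ℝ (Fin (m+2))) := (↑) '' t with hT
  have hT1 : ∀ y ∈ T, ‖y‖ = 1 := by
    rintro _ ⟨y, -, rfl⟩
    simp
  have hfin : ediam t ≠ ∞ := ne_top_of_le_ne_top ENNReal.ofReal_ne_top htd
  set d := (ediam t).toReal with hd
  have hde : ediam t = ENNReal.ofReal d := (ENNReal.ofReal_toReal hfin).symm
  have hd0 : 0 ≤ d := ENNReal.toReal_nonneg
  have hdδ : d ≤ δ := ENNReal.toReal_le_of_le_ofReal hδ.le htd
  have hTd : ∀ y ∈ T, ∀ z ∈ T, ‖y - z‖ ≤ d := by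
    rintro _ ⟨y, hy, rfl⟩ _ ⟨z, hz, rfl⟩
    have := edist_le_ediam_of_mem hy hz
    rw [hde, edist_dist, ENNReal.ofReal_le_ofReal_iff hd0] at this
    rwa [← dist_eq_norm]
  have hsh := erh_shell T hT1 δ d hδ hδ1 hdδ hTd
  rw [Measure.toSphere_apply' _ htc]
  set S := Ioo (0:ℝ) 1 • T with hS
  have hSfin : volume S ≠ ∞ := by
    have : S ⊆ ball 0 1 := by
      rintro _ ⟨r, hr, y, hy, rfl⟩
      simp [norm_smul, hT1 y hy, abs_of_pos hr.1, hr.2]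
    exact ne_top_of_le_ne_top measure_ball_lt_top.ne (measure_mono this)
  have hsub : S ⊆ (1 - δ) • S ∪ Ico (1 - δ) 1 • T := by
    rintro _ ⟨r, hr, y, hy, rfl⟩
    by_cases h : r < 1 - δ
    · left
      have h1 : 0 < 1 - δ := by linarith
      refine ⟨(r / (1 - δ)) • y, ⟨r / (1-δ), ⟨div_pos hr.1 h1, (div_lt_one h1).2 h⟩, y, hy, rfl⟩, ?_⟩
      simp only [smul_smul]
      congr 1
      field_simp
    · right
      exact ⟨r, ⟨not_lt.1 h, hr.2⟩, y, hy, rfl⟩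
  have hvol : volume S ≤ ENNReal.ofReal ((1-δ)^(m+2)) * volume S +
      ENNReal.ofReal (δ + δ^2/2) * ENNReal.ofReal ((1 + δ) * d) ^ (m+1) := by
    refine (measure_mono hsub).trans ((measure_union_le _ _).trans ?_)
    gcongr
    rw [Measure.addHaar_smul_of_nonneg _ (by linarith)]
    simp
  obtain ⟨V, hV0, hV⟩ : ∃ V : ℝ, 0 ≤ V ∧ volume S = ENNReal.ofReal V :=
    ⟨_, ENNReal.toReal_nonneg, (ENNReal.ofReal_toReal hSfin).symm⟩
  have h1δ : 0 ≤ 1 - δ := by linarith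
  have hreal : V ≤ (1-δ)^(m+2) * V + (δ + δ^2/2) * ((1+δ)*d)^(m+1) := by
    rw [hV, ← ENNReal.ofReal_pow (by positivity), ← ENNReal.ofReal_mul (by positivity),
      ← ENNReal.ofReal_mul (by positivity), ← ENNReal.ofReal_add (by positivity) (by positivity),
      ENNReal.ofReal_le_ofReal_iff (by positivity)] at hvol
    exact hvol
  have hfr : ((Module.finrank ℝ (EuclideanSpace ℝ (Fin (m+2))) : ℕ) : ℝ≥0∞) =
      ENNReal.ofReal ((m:ℝ)+2) := by
    rw [finrank_euclideanSpace_fin, ← ENNReal.ofReal_natCast]; push_cast; rfl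
  rw [hfr, hV, hde, ENNReal.rpow_natCast, ← ENNReal.ofReal_pow hd0,
    ← ENNReal.ofReal_mul (by positivity), ← ENNReal.ofReal_mul (erhC_pos m δ hδ hδ1).le]
  refine ENNReal.ofReal_le_ofReal ?_
  have hgeom : (∑ i ∈ Finset.range (m+2), (1-δ)^i) * δ = 1 - (1-δ)^(m+2) := by
    have := geom_sum_mul_neg (1-δ) (m+2)
    simpa using this
  have hG : 0 < ∑ i ∈ Finset.range (m+2), (1-δ)^i :=
    Finset.sum_pos (fun i _ => pow_pos (by linarith) i) (by simp)
  set G := ∑ i ∈ Finset.range (m+2), (1-δ)^i with hGd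
  have h2 : G * V ≤ (1 + δ/2) * ((1+δ)*d)^(m+1) := by
    have : δ * (G * V) ≤ δ * ((1 + δ/2) * ((1+δ)*d)^(m+1)) := by
      calc δ * (G * V) = (1 - (1-δ)^(m+2)) * V := by rw [← hgeom]; ring
        _ ≤ (δ + δ^2/2) * ((1+δ)*d)^(m+1) := by linarith
        _ = _ := by ring
    exact le_of_mul_le_mul_left this hδ
  unfold erhC
  rw [← hGd, div_mul_eq_mul_div, le_div_iff₀ hG]
  calc ((m:ℝ)+2) * V * G = ((m:ℝ)+2) * (G * V) := by ring
    _ ≤ ((m:ℝ)+2) * ((1 + δ/2) * ((1+δ)*d)^(m+1)) := by gcongr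
    _ = _ := by rw [mul_pow]; ring

theorem erh_toSphere_le (m : ℕ) (s : Set (sphere (0 : EuclideanSpace ℝ (Fin (m+2))) 1)) :
    (volume : Measure (EuclideanSpace ℝ (Fin (m+2)))).toSphere s ≤ μH[((m+1 : ℕ) : ℝ)] s := by
  set ν := (volume : Measure (EuclideanSpace ℝ (Fin (m+2)))).toSphere with hν
  have h1 : ∀ δ : ℝ, 0 < δ → δ < 1 → ν s ≤ ENNReal.ofReal (erhC m δ) * μH[((m+1 : ℕ) : ℝ)] s := by
    intro δ hδ hδ1
    have hC := erhC_pos m δ hδ hδ1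
    have hC0 : ENNReal.ofReal (erhC m δ) ≠ 0 := by simpa using hC
    have hle : (ENNReal.ofReal (erhC m δ))⁻¹ • ν ≤ μH[((m+1 : ℕ) : ℝ)] := by
      refine Measure.le_hausdorffMeasure _ _ (ENNReal.ofReal δ) (by simpa using hδ) ?_
      intro t ht
      have := erh_piece (closure t) isClosed_closure.measurableSet δ hδ hδ1 (by simpa using ht)
      rw [ediam_closure] at this
      rw [Measure.smul_apply, smul_eq_mul, ENNReal.inv_mul_le_iff hC0 ENNReal.ofReal_ne_top]
      exact (measure_mono subset_closure).trans this
    have := hle s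
    rwa [Measure.smul_apply, smul_eq_mul, ENNReal.inv_mul_le_iff hC0 ENNReal.ofReal_ne_top] at this
  have hlim : Tendsto (fun δ => ENNReal.ofReal (erhC m δ) * μH[((m+1 : ℕ) : ℝ)] s) (𝓝[>] 0)
      (𝓝 (μH[((m+1 : ℕ) : ℝ)] s)) := by
    have h := ENNReal.Tendsto.mul_const (b := μH[((m+1 : ℕ) : ℝ)] s) (ENNReal.tendsto_ofReal (erhC_tendsto m)) (Or.inl (by simp))
    simpa using h
  refine ge_of_tendsto hlim ?_
  filter_upwards [Ioo_mem_nhdsGT (zero_lt_one' ℝ)] with δ hδ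
  exact h1 δ hδ.1 hδ.2

theorem erh_sphere_compare (m : ℕ) (R : ℝ) (hR : 0 < R) (g : EuclideanSpace ℝ (Fin (m+2)) → ℝ)
    (hg : Continuous g) (hg0 : ∀ x, 0 ≤ g x) :
    R ^ (m+1) * ∫ ω : sphere (0 : EuclideanSpace ℝ (Fin (m+2))) 1,
      g (R • (ω : EuclideanSpace ℝ (Fin (m+2))))
      ∂(volume : Measure (EuclideanSpace ℝ (Fin (m+2)))).toSphere ≤
    ∫ y in sphere (0 : EuclideanSpace ℝ (Fin (m+2))) R, g y ∂(μH[((m+1 : ℕ) : ℝ)]) := by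
  set ν := (volume : Measure (EuclideanSpace ℝ (Fin (m+2)))).toSphere with hν
  set φ : sphere (0 : EuclideanSpace ℝ (Fin (m+2))) 1 → EuclideanSpace ℝ (Fin (m+2)) :=
    fun ω => R • (ω : EuclideanSpace ℝ (Fin (m+2))) with hφ
  have hφc : Continuous φ := by fun_prop
  have hscale : ∀ s : Set (EuclideanSpace ℝ (Fin (m+2))),
      μH[((m+1 : ℕ) : ℝ)] (R • s) = ENNReal.ofReal (R ^ (m+1)) * μH[((m+1 : ℕ) : ℝ)] s := by
    intro s
    rw [Measure.hausdorffMeasure_smul₀ (by positivity) hR.ne', NNReal.rpow_natCast,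
      ENNReal.ofReal_pow hR.le, ENNReal.smul_def, smul_eq_mul, ENNReal.coe_pow,
      ← Real.enorm_of_nonneg hR.le]
    rfl
  have hsph : sphere (0 : EuclideanSpace ℝ (Fin (m+2))) R ⊆ R • sphere 0 1 := by
    intro y hy
    refine ⟨R⁻¹ • y, ?_, by simp [smul_smul, hR.ne']⟩
    have : ‖y‖ = R := by simpa using hy
    simp [norm_smul, this, abs_of_pos hR, hR.ne']
  have hfin : IsFiniteMeasure ((μH[((m+1 : ℕ) : ℝ)]).restrict
      (sphere (0 : EuclideanSpace ℝ (Fin (m+2))) R)) := by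
    refine ⟨?_⟩
    rw [Measure.restrict_apply_univ]
    refine (measure_mono hsph).trans_lt ?_
    rw [hscale]
    exact ENNReal.mul_lt_top ENNReal.ofReal_lt_top (erh_sphere_finite m)
  have hle : ENNReal.ofReal (R ^ (m+1)) • ν.map φ ≤ (μH[((m+1 : ℕ) : ℝ)]).restrict
      (sphere (0 : EuclideanSpace ℝ (Fin (m+2))) R) := by
    refine Measure.le_iff.2 ?_
    intro s hs
    rw [Measure.smul_apply, smul_eq_mul, Measure.map_apply hφc.measurable hs,
      Measure.restrict_apply hs]
    calc ENNReal.ofReal (R ^ (m+1)) * ν (φ ⁻¹' s)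
        ≤ ENNReal.ofReal (R ^ (m+1)) * μH[((m+1 : ℕ) : ℝ)] (φ ⁻¹' s) := by
          exact mul_le_mul_right (erh_toSphere_le m _) _
      _ = ENNReal.ofReal (R ^ (m+1)) * μH[((m+1 : ℕ) : ℝ)] (Subtype.val '' (φ ⁻¹' s)) := by
          rw [isometry_subtype_coe.hausdorffMeasure_image (Or.inl (by positivity))]
      _ = μH[((m+1 : ℕ) : ℝ)] (R • (Subtype.val '' (φ ⁻¹' s))) := (hscale _).symm
      _ ≤ _ := by
          refine measure_mono ?_
          rintro _ ⟨_, ⟨ω, hω, rfl⟩, rfl⟩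
          refine ⟨hω, ?_⟩
          simp [norm_smul, abs_of_pos hR]
  have hint : Integrable g ((μH[((m+1 : ℕ) : ℝ)]).restrict
      (sphere (0 : EuclideanSpace ℝ (Fin (m+2))) R)) := by
    obtain ⟨C, hC⟩ := (isCompact_sphere (0 : EuclideanSpace ℝ (Fin (m+2))) R).exists_bound_of_continuousOn
      hg.continuousOn
    refine Integrable.of_bound hg.aestronglyMeasurable C ?_
    filter_upwards [ae_restrict_mem isClosed_sphere.measurableSet] with x hx
    exact hC x hx
  have := integral_mono_measure hle (.of_forall hg0) hint
  rw [integral_smul_measure, integral_map hφc.aemeasurable hg.aestronglyMeasurable,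
    ENNReal.toReal_ofReal (by positivity), smul_eq_mul] at this
  exact this

theorem erh_polar (m : ℕ) (F : EuclideanSpace ℝ (Fin (m+2)) → ℝ) (hF : Integrable F) :
    (∀ᵐ ω : sphere (0 : EuclideanSpace ℝ (Fin (m+2))) 1 ∂(volume : Measure (EuclideanSpace ℝ (Fin (m+2)))).toSphere,
      IntegrableOn (fun r : ℝ => r ^ (m+1) * F (r • (ω : EuclideanSpace ℝ (Fin (m+2))))) (Ioi 0)) ∧
    Integrable (fun ω : sphere (0 : EuclideanSpace ℝ (Fin (m+2))) 1 =>
      ∫ r in Ioi (0:ℝ), r ^ (m+1) * F (r • (ω : EuclideanSpace ℝ (Fin (m+2)))))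
      (volume : Measure (EuclideanSpace ℝ (Fin (m+2)))).toSphere ∧
    ∫ x, F x = ∫ ω, (∫ r in Ioi (0:ℝ), r ^ (m+1) * F (r • (ω : EuclideanSpace ℝ (Fin (m+2)))))
      ∂(volume : Measure (EuclideanSpace ℝ (Fin (m+2)))).toSphere := by
  set μ : Measure (EuclideanSpace ℝ (Fin (m+2))) := volume with hμ
  have hdim : Module.finrank ℝ (EuclideanSpace ℝ (Fin (m+2))) - 1 = m + 1 := by simp
  have mp := μ.measurePreserving_homeomorphUnitSphereProd
  rw [hdim] at mp
  set G : sphere (0 : EuclideanSpace ℝ (Fin (m+2))) 1 × Ioi (0:ℝ) → ℝ :=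
    fun p => F ((p.2 : ℝ) • (p.1 : EuclideanSpace ℝ (Fin (m+2)))) with hG
  have hcomp : ∀ x : ({(0)}ᶜ : Set (EuclideanSpace ℝ (Fin (m+2)))),
      G (homeomorphUnitSphereProd _ x) = F x := by
    intro x
    have hx : ‖(x : EuclideanSpace ℝ (Fin (m+2)))‖ ≠ 0 := norm_ne_zero_iff.2 x.2
    simp [hG, smul_smul, hx]
  have hint : ∫ x, F x ∂μ = ∫ p, G p ∂(μ.toSphere.prod (.volumeIoiPow (m+1))) := by
    rw [← mp.integral_comp (Homeomorph.measurableEmbedding _) G]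
    simp_rw [hcomp]
    rw [integral_subtype_comap (measurableSet_singleton _).compl F,
      restrict_compl_singleton]
  have hGi : Integrable G (μ.toSphere.prod (.volumeIoiPow (m+1))) := by
    rw [← mp.integrable_comp_emb (Homeomorph.measurableEmbedding _)]
    have : G ∘ (homeomorphUnitSphereProd (EuclideanSpace ℝ (Fin (m+2)))) = F ∘ Subtype.val := by
      ext x; exact hcomp x
    rw [this, ← integrableOn_iff_comap_subtypeVal (by measurability)]
    exact hF.integrableOn
  have hin : ∀ ω : sphere (0 : EuclideanSpace ℝ (Fin (m+2))) 1,
      ∫ r, G (ω, r) ∂(Measure.volumeIoiPow (m+1)) =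
      ∫ r in Ioi (0:ℝ), r ^ (m+1) * F (r • (ω : EuclideanSpace ℝ (Fin (m+2)))) := by
    intro ω
    simp only [Measure.volumeIoiPow, ENNReal.ofReal, hG]
    rw [integral_withDensity_eq_integral_smul,
        integral_subtype_comap measurableSet_Ioi
          fun a ↦ Real.toNNReal (a ^ (m+1)) • F (a • (ω : EuclideanSpace ℝ (Fin (m+2)))),
        setIntegral_congr_fun measurableSet_Ioi fun x hx ↦ ?_]
    · simp only [NNReal.smul_def, Real.coe_toNNReal _ (pow_nonneg hx.out.le _), smul_eq_mul]
    · exact (measurable_subtype_coe.pow_const _).real_toNNReal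
  refine ⟨?_, ?_, ?_⟩
  · filter_upwards [hGi.prod_right_ae] with ω hω
    rw [Measure.volumeIoiPow, integrable_withDensity_iff_integrable_smul'] at hω
    · rw [integrableOn_iff_comap_subtypeVal measurableSet_Ioi]
      refine hω.congr (.of_forall ?_)
      rintro ⟨x, hx : 0 < x⟩
      simp (disch := positivity) [ENNReal.toReal_ofReal, hG]
    · fun_prop
    · simp
  · have := hGi.integral_prod_left
    simpa only [hin] using this
  · rw [hint, integral_prod _ hGi]
    simp only [hin]

theorem erh_oneD (m : ℕ) (R σ : ℝ) (hR : 0 < R) (hσ : 0 < σ) (f f' Φ : ℝ → ℝ)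
    (hf : ∀ r, HasDerivAt f (f' r) r) (hf' : Continuous f')
    (M : ℝ) (hM : ∀ r, M ≤ r → f r = 0) 
    (hΦ : IntegrableOn Φ (Ioi R))
    (hle : ∀ r, R < r → r ^ (m+1) * (f' r ^ 2 - (1/4 * (((r - R + 1 / (2*σ))^2)⁻¹ * f r ^ 2)
      + ((m:ℝ)+1) * ((m:ℝ) - 1) / 4 * (f r ^ 2 / r ^ 2))) ≤ Φ r) :
    -(σ * (R ^ (m+1) * f R ^ 2)) ≤ ∫ r in Ioi R, Φ r := by
  set c : ℝ := 1 / (2 * σ) with hc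
  have hc0 : 0 < c := by positivity
  set h : ℝ → ℝ := fun r => 1/2 * (r - R + c)⁻¹ - ((m:ℝ)+1)/2 * r⁻¹ with hh
  set h' : ℝ → ℝ := fun r => 1/2 * (-1 / (r - R + c)^2) - ((m:ℝ)+1)/2 * (-1/r^2) with hh'
  have hhd : ∀ r ∈ Ici R, HasDerivAt h (h' r) r := by
    intro r hr
    have h1 : r - R + c ≠ 0 := by have := hr.out; exact ne_of_gt (by linarith)
    have h2 : r ≠ 0 := (hR.trans_le hr).ne'
    refine HasDerivAt.sub (HasDerivAt.const_mul _ ?_) (HasDerivAt.const_mul _ ?_)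
    · exact (((hasDerivAt_id r).sub_const R).add_const c).fun_inv h1
    · exact (hasDerivAt_id r).fun_inv h2
  set P : ℝ → ℝ := fun r => f r ^ 2 * (h r * r ^ (m+1)) with hP
  set D : ℝ → ℝ := fun r => (2 * f r * f' r) * (h r * r ^ (m+1)) +
    f r ^ 2 * (h' r * r ^ (m+1) + h r * (((m:ℝ)+1) * r ^ m)) with hD
  have hPd : ∀ r ∈ Ici R, HasDerivAt P (D r) r := by
    intro r hr
    have h1 : HasDerivAt (fun r => f r ^ 2) (2 * f r * f' r) r := by
      simpa using (hf r).fun_pow 2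
    have h2 : HasDerivAt (fun r : ℝ => r ^ (m+1)) (((m:ℝ)+1) * r ^ m) r := by
      simpa using hasDerivAt_pow (m+1) r
    exact h1.mul ((hhd r hr).mul h2)
  have hfc : Continuous f := continuous_iff_continuousAt.2 fun r => (hf r).continuousAt
  have hDc : ContinuousOn D (Ici R) := by
    have e1 : ContinuousOn h (Ici R) := fun r hr => (hhd r hr).continuousAt.continuousWithinAt
    have e2 : ContinuousOn h' (Ici R) := by
      have a1 : ∀ r ∈ Ici R, (r - R + c)^2 ≠ 0 := by
        intro r hr
        have := hr.out
        have : 0 < r - R + c := by linarith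
        positivity
      have a2 : ∀ r ∈ Ici R, r^2 ≠ 0 := by
        intro r hr
        have := hR.trans_le hr
        positivity
      simp only [hh']
      fun_prop (disch := assumption)
    simp only [hD]
    fun_prop
  have hDi : IntegrableOn D (Ioi R) := by
    have : IntegrableOn D (Icc R M) :=
      (hDc.mono Icc_subset_Ici_self).integrableOn_Icc
    refine this.of_forall_sdiff_eq_zero measurableSet_Ioi ?_
    intro r hr
    have : M ≤ r := by
      by_contra hlt
      exact hr.2 ⟨hr.1.out.le, (not_le.1 hlt).le⟩
    simp [hD, hM r this]
  have hlim : Tendsto P atTop (𝓝 0) := by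
    refine tendsto_const_nhds.congr' ?_
    filter_upwards [eventually_ge_atTop M] with r hr
    simp [hP, hM r hr]
  have key := integral_Ioi_of_hasDerivAt_of_tendsto' hPd hDi hlim
  have hmono : ∫ r in Ioi R, D r ≤ ∫ r in Ioi R, Φ r := by
    refine setIntegral_mono_on hDi hΦ measurableSet_Ioi ?_
    intro r hr
    refine le_trans ?_ (hle r hr)
    have hr0 : 0 < r := hR.trans hr
    have h1 : 0 < r - R + c := by have := hr.out; linarith
    have : r ^ (m+1) * (f' r ^ 2 - (1/4 * (((r - R + c)^2)⁻¹ * f r ^ 2)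
      + ((m:ℝ)+1) * ((m:ℝ) - 1) / 4 * (f r ^ 2 / r ^ 2))) - D r
      = r ^ (m+1) * (f' r - h r * f r) ^ 2 := by
      simp only [hD, hh, hh']
      field_simp
      ring
    have h3 : 0 ≤ r ^ (m+1) * (f' r - h r * f r) ^ 2 := by positivity
    linarith
  rw [key] at hmono
  refine le_trans ?_ hmono
  have hhR : h R = σ - ((m:ℝ)+1)/2 * R⁻¹ := by
    simp only [hh, hc]; field_simp; ring
  simp only [hP, hhR]
  have : 0 ≤ f R ^ 2 * (((m:ℝ)+1)/2 * R⁻¹ * R^(m+1)) := by positivity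
  nlinarith

theorem erh_integrableOn {m : ℕ} (R : ℝ) (K : Set (EuclideanSpace ℝ (Fin (m+2)))) (hK : IsCompact K)
    (G : EuclideanSpace ℝ (Fin (m+2)) → ℝ)
    (hG : ContinuousOn G {x | R ≤ ‖x‖}) (h0 : ∀ x, x ∉ K → G x = 0) :
    IntegrableOn G {x | R < ‖x‖} := by
  have hc : IsClosed {x : EuclideanSpace ℝ (Fin (m+2)) | R ≤ ‖x‖} :=
    isClosed_le continuous_const continuous_norm
  have h1 : IntegrableOn G (K ∩ {x | R ≤ ‖x‖}) :=
    (hG.mono inter_subset_right).integrableOn_compact (hK.inter_right hc)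
  refine h1.of_forall_sdiff_eq_zero (isOpen_lt continuous_const continuous_norm).measurableSet ?_
  intro x hx
  refine h0 x fun hxK => hx.2 ⟨hxK, ?_⟩
  exact le_of_lt (show R < ‖x‖ from hx.1)

theorem erh_main (m : ℕ) (R σ : ℝ) (hR : 0 < R) (hσ : 0 < σ)
    (u : EuclideanSpace ℝ (Fin (m+2)) → ℝ)
    (hu : ContDiff ℝ (⊤ : ℕ∞) u) (hsupp : HasCompactSupport u) :
    (∫ x in {x : EuclideanSpace ℝ (Fin (m+2)) | R < ‖x‖}, ‖gradient u x‖ ^ 2)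
      + σ * (∫ y in Metric.sphere (0 : EuclideanSpace ℝ (Fin (m+2))) R,
          u y ^ 2 ∂(μH[((m+1 : ℕ) : ℝ)])) ≥
      (1 / 4) * (∫ x in {x : EuclideanSpace ℝ (Fin (m+2)) | R < ‖x‖},
          ((‖x‖ - R + 1 / (2 * σ)) ^ 2)⁻¹ * u x ^ 2)
        + ((m:ℝ)+1) * ((m:ℝ) - 1) / 4 *
          ∫ x in {x : EuclideanSpace ℝ (Fin (m+2)) | R < ‖x‖}, u x ^ 2 / ‖x‖ ^ 2 := by
  have hgn : ∀ x, ‖gradient u x‖ = ‖fderiv ℝ u x‖ := by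
    intro x; simp [gradient]
  have hdc : Continuous (fderiv ℝ u) := hu.continuous_fderiv (by simp)
  have hdiff : Differentiable ℝ u := hu.differentiable (by simp)
  have huc : Continuous u := hu.continuous
  have hu0 : ∀ x, x ∉ tsupport u → u x = 0 := fun x hx => image_eq_zero_of_notMem_tsupport hx
  have hdu0 : ∀ x, x ∉ tsupport u → fderiv ℝ u x = 0 := fun x hx =>
    Function.notMem_support.1 fun h => hx (support_fderiv_subset ℝ h)
  set A : Set (EuclideanSpace ℝ (Fin (m+2))) := {x | R < ‖x‖} with hA
  have hAm : MeasurableSet A := (isOpen_lt continuous_const continuous_norm).measurableSet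
  have hc0 : 0 < 1 / (2 * σ) := by positivity
  have i1 : IntegrableOn (fun x => ‖gradient u x‖ ^ 2) A := by
    refine erh_integrableOn R (tsupport u) hsupp _ ?_ ?_
    · simp only [hgn]; fun_prop
    · intro x hx; simp [hgn, hdu0 x hx]
  have i2 : IntegrableOn (fun x => ((‖x‖ - R + 1 / (2 * σ)) ^ 2)⁻¹ * u x ^ 2) A := by
    refine erh_integrableOn R (tsupport u) hsupp _ ?_ ?_
    · have : ∀ x ∈ {x : EuclideanSpace ℝ (Fin (m+2)) | R ≤ ‖x‖},
          (‖x‖ - R + 1 / (2 * σ)) ^ 2 ≠ 0 := by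
        intro x hx
        have hx : R ≤ ‖x‖ := hx
        have : 0 < ‖x‖ - R + 1 / (2 * σ) := by linarith
        positivity
      refine ContinuousOn.mul (ContinuousOn.inv₀ (by fun_prop) this) (by fun_prop)
    · intro x hx; simp [hu0 x hx]
  have i3 : IntegrableOn (fun x => u x ^ 2 / ‖x‖ ^ 2) A := by
    refine erh_integrableOn R (tsupport u) hsupp _ ?_ ?_
    · have : ∀ x ∈ {x : EuclideanSpace ℝ (Fin (m+2)) | R ≤ ‖x‖}, ‖x‖ ^ 2 ≠ 0 := by
        intro x hx
        have hx : R ≤ ‖x‖ := hx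
        have : 0 < ‖x‖ := by linarith
        positivity
      exact ContinuousOn.div (by fun_prop) (by fun_prop) this
    · intro x hx; simp [hu0 x hx]
  set H : EuclideanSpace ℝ (Fin (m+2)) → ℝ := fun x => ‖gradient u x‖ ^ 2 -
    (1 / 4 * (((‖x‖ - R + 1 / (2 * σ)) ^ 2)⁻¹ * u x ^ 2) +
      ((m:ℝ)+1) * ((m:ℝ) - 1) / 4 * (u x ^ 2 / ‖x‖ ^ 2)) with hH
  have i4 : Integrable (fun x => 1 / 4 * (((‖x‖ - R + 1 / (2 * σ)) ^ 2)⁻¹ * u x ^ 2) +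
      ((m:ℝ)+1) * ((m:ℝ) - 1) / 4 * (u x ^ 2 / ‖x‖ ^ 2)) (volume.restrict A) :=
    (i2.const_mul (1/4)).add (i3.const_mul (((m:ℝ)+1) * ((m:ℝ) - 1) / 4))
  have hHi : IntegrableOn H A := i1.sub i4
  have hHint : ∫ x in A, H x = (∫ x in A, ‖gradient u x‖ ^ 2) -
      ((1 / 4) * (∫ x in A, ((‖x‖ - R + 1 / (2 * σ)) ^ 2)⁻¹ * u x ^ 2)
        + ((m:ℝ)+1) * ((m:ℝ) - 1) / 4 * ∫ x in A, u x ^ 2 / ‖x‖ ^ 2) := by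
    simp only [hH]
    rw [integral_sub i1 i4, integral_add (i2.const_mul _) (i3.const_mul _),
      integral_const_mul, integral_const_mul]
  obtain ⟨p1, p2, p3⟩ := erh_polar m (A.indicator H) (hHi.integrable_indicator hAm)
  rw [integral_indicator hAm] at p3
  have hcmp := erh_sphere_compare m R hR (fun x => u x ^ 2) (by fun_prop) (fun x => sq_nonneg _)
  obtain ⟨M, hM⟩ := hsupp.isBounded.subset_ball (0 : EuclideanSpace ℝ (Fin (m+2)))
  have hbound : ∀ᵐ ω : sphere (0 : EuclideanSpace ℝ (Fin (m+2))) 1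
      ∂(volume : Measure (EuclideanSpace ℝ (Fin (m+2)))).toSphere,
      -(σ * (R ^ (m+1) * u (R • (ω : EuclideanSpace ℝ (Fin (m+2)))) ^ 2)) ≤
      ∫ r in Ioi (0:ℝ), r ^ (m+1) * A.indicator H (r • (ω : EuclideanSpace ℝ (Fin (m+2)))) := by
    filter_upwards [p1] with ω hω
    have hω1 : ‖(ω : EuclideanSpace ℝ (Fin (m+2)))‖ = 1 := by simp
    have hn : ∀ r : ℝ, 0 < r → ‖r • (ω : EuclideanSpace ℝ (Fin (m+2)))‖ = r := by
      intro r hr; rw [norm_smul, hω1, Real.norm_eq_abs, abs_of_pos hr, mul_one]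
    have e : (∫ r in Ioi (0:ℝ), r ^ (m+1) * A.indicator H (r • (ω : EuclideanSpace ℝ (Fin (m+2)))))
        = ∫ r in Ioi R, r ^ (m+1) * A.indicator H (r • (ω : EuclideanSpace ℝ (Fin (m+2)))) := by
      refine setIntegral_eq_of_subset_of_forall_sdiff_eq_zero measurableSet_Ioi
        (Ioi_subset_Ioi hR.le) ?_
      intro r hr
      have : r • (ω : EuclideanSpace ℝ (Fin (m+2))) ∉ A := by
        intro h
        refine hr.2 ?_
        have h : R < ‖r • (ω : EuclideanSpace ℝ (Fin (m+2)))‖ := h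
        rwa [hn r hr.1] at h
      simp [this]
    rw [e]
    refine erh_oneD m R σ hR hσ (fun r => u (r • (ω : EuclideanSpace ℝ (Fin (m+2)))))
      (fun r => fderiv ℝ u (r • (ω : EuclideanSpace ℝ (Fin (m+2)))) ω) _ ?_ (by fun_prop)
      (max M 1) ?_ (hω.mono_set (Ioi_subset_Ioi hR.le)) ?_
    · intro r
      have h1 : HasDerivAt (fun r : ℝ => r • (ω : EuclideanSpace ℝ (Fin (m+2)))) ω r := by
        simpa using (hasDerivAt_id r).smul_const (ω : EuclideanSpace ℝ (Fin (m+2)))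
      exact (hdiff _).hasFDerivAt.comp_hasDerivAt r h1
    · intro r hr
      refine hu0 _ fun h => ?_
      have := hM h
      rw [mem_ball_zero_iff, hn r (lt_of_lt_of_le one_pos ((le_max_right _ _).trans hr))] at this
      linarith [le_max_left M 1]
    · intro r hr
      have hr0 : 0 < r := hR.trans hr
      have hmem : r • (ω : EuclideanSpace ℝ (Fin (m+2))) ∈ A := by
        change R < _
        rwa [hn r hr0]
      rw [indicator_of_mem hmem]
      simp only [hH, hn r hr0, hgn]
      have : (fderiv ℝ u (r • (ω : EuclideanSpace ℝ (Fin (m+2)))) ω) ^ 2 ≤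
          ‖fderiv ℝ u (r • (ω : EuclideanSpace ℝ (Fin (m+2))))‖ ^ 2 := by
        rw [sq_le_sq, abs_norm, ← Real.norm_eq_abs]
        have := (fderiv ℝ u (r • (ω : EuclideanSpace ℝ (Fin (m+2))))).le_opNorm ω
        rwa [hω1, mul_one] at this
      gcongr
  have hi : Integrable (fun ω : sphere (0 : EuclideanSpace ℝ (Fin (m+2))) 1 =>
      -(σ * (R ^ (m+1) * u (R • (ω : EuclideanSpace ℝ (Fin (m+2)))) ^ 2)))
      (volume : Measure (EuclideanSpace ℝ (Fin (m+2)))).toSphere := by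
    refine Continuous.integrable_of_hasCompactSupport (by fun_prop) ?_
    exact HasCompactSupport.of_compactSpace _
  have hfin := integral_mono_ae hi p2 hbound
  rw [← p3, integral_neg, integral_const_mul, integral_const_mul, hHint] at hfin
  have := mul_le_mul_of_nonneg_left hcmp hσ.le
  linarith

theorem exterior_robin_hardy (n : ℕ) (hn : 2 ≤ n) (R σ : ℝ) (hR : 0 < R) (hσ : 0 < σ)
    (u : EuclideanSpace ℝ (Fin n) → ℝ)
    (hu : ContDiff ℝ (⊤ : ℕ∞) u) (hsupp : HasCompactSupport u) :
    (∫ x in {x : EuclideanSpace ℝ (Fin n) | R < ‖x‖}, ‖gradient u x‖ ^ 2)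
      + σ * (∫ y in Metric.sphere (0 : EuclideanSpace ℝ (Fin n)) R,
          u y ^ 2 ∂(μH[(n : ℝ) - 1])) ≥
      (1 / 4) * (∫ x in {x : EuclideanSpace ℝ (Fin n) | R < ‖x‖},
          ((‖x‖ - R + 1 / (2 * σ)) ^ 2)⁻¹ * u x ^ 2)
        + ((n : ℝ) - 1) * ((n : ℝ) - 3) / 4 *
          ∫ x in {x : EuclideanSpace ℝ (Fin n) | R < ‖x‖}, u x ^ 2 / ‖x‖ ^ 2 := by
  obtain ⟨m, rfl⟩ : ∃ m, n = m + 2 := ⟨n - 2, by omega⟩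
  have e1 : ((m + 2 : ℕ) : ℝ) - 1 = ((m + 1 : ℕ) : ℝ) := by push_cast; ring
  have e2 : ((m + 2 : ℕ) : ℝ) - 3 = (m : ℝ) - 1 := by push_cast; ring
  have e3 : ((m + 1 : ℕ) : ℝ) = (m : ℝ) + 1 := by push_cast; ring
  have h := erh_main m R σ hR hσ u hu hsupp
  rw [e1, e2]
  rw [← e3] at h
  exact h
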